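/- Let ι : Q → P be an aligned grid inclusion with Q finite and ↑ι(Q) = P. Then the right adjoint ⌊−⌋_ι : P → Q of ι is an upper semilattice morphism; that is, ⌊x ∨ y⌋_ι = ⌊x⌋_ι ∨ ⌊y⌋_ι for all x, y ∈ P. -/

import Mathlib

namespace SpreadPaper

/-- The upset generated by a set. -/
def upSet (P : Type) [PartialOrder P] (S : Set P) : Set P := {p | ∃ s ∈ S, s ≤ p}

/-- If `fl` is right adjoint to a coordinatewise map `ι`, then each coordinate of `fl` bounds every
element whose image lies below the corresponding coordinate. -/
theorem le_floor_apply {I : Type*} {Q P : I → Type*}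
    [∀ i, Preorder (Q i)] [∀ i, Preorder (P i)] {f : ∀ i, Q i → P i}
    {ι : (∀ i, Q i) → (∀ i, P i)} (hι : ∀ q i, ι q i = f i (q i))
    {fl : (∀ i, P i) → (∀ i, Q i)} (hadj : GaloisConnection ι fl)
    {p : ∀ i, P i} {i : I} {a : Q i} (h : f i a ≤ p i) : a ≤ fl p i := by
  classical
  have key : ι (Function.update (fl p) i a) ≤ p := by
    intro j
    rw [hι]
    obtain rfl | hj := eq_or_ne j i
    · simpa using h
    · rw [Function.update_of_ne hj, ← hι]
      exact hadj.l_u_le p j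
  simpa using hadj.le_u key i

/-- **Lemma.** Let `ι : Q → P` be an aligned grid inclusion with `Q` finite and `↑ι(Q) = P`.
Then the right adjoint `⌊−⌋_ι : P → Q` of `ι` is an upper semilattice morphism, i.e.
`⌊x ⊔ y⌋_ι = ⌊x⌋_ι ⊔ ⌊y⌋_ι` for all `x, y ∈ P`. -/
theorem statement9 (n : ℕ) (QF PF : Fin n → Type)
    [∀ i, LinearOrder (QF i)] [∀ i, LinearOrder (PF i)] [∀ i, Fintype (QF i)]
    (f : ∀ i, QF i → PF i) (hmono : ∀ i, Monotone (f i)) (hinj : ∀ i, Function.Injective (f i))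
    (ι : (∀ i, QF i) → (∀ i, PF i)) (hι : ∀ (q : ∀ i, QF i) (i : Fin n), ι q i = f i (q i))
    (hsurj : upSet (∀ i, PF i) (Set.range ι) = Set.univ)
    (fl : (∀ i, PF i) → (∀ i, QF i))
    (hadj : ∀ (q : ∀ i, QF i) (p : ∀ i, PF i), ι q ≤ p ↔ q ≤ fl p) :
    ∀ x y : ∀ i, PF i, fl (x ⊔ y) = fl x ⊔ fl y := by
  have gc : GaloisConnection ι fl := hadj
  intro x y
  refine le_antisymm (fun i => ?_)
    (sup_le (gc.monotone_u le_sup_left) (gc.monotone_u le_sup_right))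
  have h : f i (fl (x ⊔ y) i) ≤ x i ⊔ y i := by
    rw [← hι]
    exact gc.l_u_le (x ⊔ y) i
  rcases le_sup_iff.mp h with hx | hy
  · exact (le_floor_apply hι gc hx).trans le_sup_left
  · exact (le_floor_apply hι gc hy).trans le_sup_right

end SpreadPaper
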